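/- Let u^1, …, u^J be concave utility functions on finite nonempty sets A^1, …, A^J ⊂ ℤ^n, with aggregate domain A = A^1 + ⋯ + A^J and aggregate utility U. For a finite D ⊂ ℤ^n and f : D → ℝ, let the concave majorant f̃ : conv(D) → ℝ be defined by f̃(x) = max{ Σ_{d ∈ D} λ_d f(d) : λ_d ≥ 0, Σ λ_d = 1, Σ λ_d d = x }. Then for every x ∈ conv(A), Ũ(x) = max{ Σ_{j=1}^J ũ^j(x^j) : x^j ∈ conv(A^j), Σ_j x^j = x }, where Ũ and ũ^j are the concave majorants of U and u^j respectively. -/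

import Mathlib

open Pointwise

/-- Coercion of an integer vector to a real vector. -/
def intCoe {n : ℕ} (x : Fin n → ℤ) : Fin n → ℝ := fun i => (x i : ℝ)

/-- Dot product of a real price vector with an integer bundle. -/
noncomputable def dotP {n : ℕ} (p : Fin n → ℝ) (a : Fin n → ℤ) : ℝ := ∑ i, p i * (a i : ℝ)

/-- The demand set of an agent with bundle set `A` and utility `u` at price `p`. -/
def demandSet {n : ℕ} (A : Finset (Fin n → ℤ)) (u : (Fin n → ℤ) → ℝ) (p : Fin n → ℝ) :
    Set (Fin n → ℤ) :=
  {a | a ∈ A ∧ ∀ b ∈ A, u b - dotP p b ≤ u a - dotP p a}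

/-- Aggregate demand set: the Minkowski sum of the individual demand sets. -/
def aggDemand {n J : ℕ} (A : Fin J → Finset (Fin n → ℤ)) (u : Fin J → (Fin n → ℤ) → ℝ)
    (p : Fin n → ℝ) : Set (Fin n → ℤ) :=
  {x | ∃ f : Fin J → (Fin n → ℤ), (∀ j, f j ∈ demandSet (A j) (u j) p) ∧ ∑ j, f j = x}

/-- Aggregate domain: the Minkowski sum of the bundle sets. -/
def aggDomain {n J : ℕ} (A : Fin J → Finset (Fin n → ℤ)) : Set (Fin n → ℤ) :=
  {x | ∃ f : Fin J → (Fin n → ℤ), (∀ j, f j ∈ A j) ∧ ∑ j, f j = x}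

/-- Aggregate utility. -/
noncomputable def aggU {n J : ℕ} (A : Fin J → Finset (Fin n → ℤ)) (u : Fin J → (Fin n → ℤ) → ℝ)
    (a : Fin n → ℤ) : ℝ :=
  sSup {t | ∃ f : Fin J → (Fin n → ℤ), (∀ j, f j ∈ A j) ∧ ∑ j, f j = a ∧ t = ∑ j, u j (f j)}

/-- A vector in `ℤ^n` is primitive if the gcd of its coordinates is 1. -/
def IsPrimitive {n : ℕ} (v : Fin n → ℤ) : Prop := Finset.univ.gcd v = 1

/-- A set of integer vectors is unimodular if every linearly independent subset of `n` of its
vectors is a `ℤ`-basis of `ℤ^n`. -/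
def IsUnimodular {n : ℕ} (D : Set (Fin n → ℤ)) : Prop :=
  ∀ s : Finset (Fin n → ℤ), ↑s ⊆ D → s.card = n →
    LinearIndependent ℤ (fun x : (s : Set (Fin n → ℤ)) => (x : Fin n → ℤ)) →
    Submodule.span ℤ (s : Set (Fin n → ℤ)) = ⊤

/-- Every edge (one-dimensional face, i.e. extreme segment) of `P` is parallel to a vector of `D`. -/
def EdgesParallelTo {n : ℕ} (P : Set (Fin n → ℝ)) (D : Set (Fin n → ℤ)) : Prop :=
  ∀ x y : Fin n → ℝ, x ≠ y → IsExtreme ℝ P (segment ℝ x y) →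
    ∃ v ∈ D, ∃ t : ℝ, y - x = t • intCoe v

/-- A utility function is of demand type `D` if every edge of every demand-set polytope is
parallel to a vector of `D`. -/
def IsDemandType {n : ℕ} (A : Finset (Fin n → ℤ)) (u : (Fin n → ℤ) → ℝ)
    (D : Set (Fin n → ℤ)) : Prop :=
  ∀ p : Fin n → ℝ, EdgesParallelTo (convexHull ℝ (intCoe '' demandSet A u p)) D

/-- A utility function on `A` is concave if `A` contains all lattice points of its convex hull
and `u` is the restriction of a concave function on `conv(A)`. -/
def IsConcaveUtility {n : ℕ} (A : Finset (Fin n → ℤ)) (u : (Fin n → ℤ) → ℝ) : Prop :=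
  (∀ x : Fin n → ℤ, intCoe x ∈ convexHull ℝ (intCoe '' (A : Set (Fin n → ℤ))) → x ∈ A) ∧
  ∃ f : (Fin n → ℝ) → ℝ,
    ConcaveOn ℝ (convexHull ℝ (intCoe '' (A : Set (Fin n → ℤ)))) f ∧
    ∀ a ∈ A, f (intCoe a) = u a

/-- The concave majorant of a function on a finite set of lattice points. -/
noncomputable def concaveMajorant {n : ℕ} (A : Finset (Fin n → ℤ)) (f : (Fin n → ℤ) → ℝ)
    (x : Fin n → ℝ) : ℝ :=
  sSup {t | ∃ lam : (Fin n → ℤ) → ℝ, (∀ d ∈ A, 0 ≤ lam d) ∧ (∑ d ∈ A, lam d) = 1 ∧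
    (∑ d ∈ A, lam d • intCoe d) = x ∧ t = ∑ d ∈ A, lam d * f d}

/-- The aggregate domain as a finite set. -/
def aggFinset {n J : ℕ} (A : Fin J → Finset (Fin n → ℤ)) : Finset (Fin n → ℤ) :=
  Finset.image (fun f => ∑ j, f j) (Fintype.piFinset A)

theorem intCoe_injective {n : ℕ} : Function.Injective (intCoe : (Fin n → ℤ) → Fin n → ℝ) := by
  intro a b h
  ext i
  exact Int.cast_injective (congrFun h i : (a i : ℝ) = b i)

theorem intCoe_sum {n : ℕ} {ι : Type*} (s : Finset ι) (z : ι → Fin n → ℤ) :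
    intCoe (∑ i ∈ s, z i) = ∑ i ∈ s, intCoe (z i) := by
  ext k
  simp [intCoe]

theorem coe_aggFinset {n J : ℕ} (A : Fin J → Finset (Fin n → ℤ)) :
    (aggFinset A : Set (Fin n → ℤ)) = aggDomain A := by
  ext a
  simp [aggFinset, aggDomain]

theorem sum_mem_aggFinset {n J : ℕ} {A : Fin J → Finset (Fin n → ℤ)} {f : Fin J → Fin n → ℤ}
    (hf : ∀ j, f j ∈ A j) : ∑ j, f j ∈ aggFinset A := by
  rw [← Finset.mem_coe, coe_aggFinset]
  exact ⟨f, hf, rfl⟩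

/-- The values of the convex combinations of `A` representing `x`, whose supremum is
`concaveMajorant A f x`. -/
def combinationValues {n : ℕ} (A : Finset (Fin n → ℤ)) (f : (Fin n → ℤ) → ℝ)
    (x : Fin n → ℝ) : Set ℝ :=
  {t | ∃ lam : (Fin n → ℤ) → ℝ, (∀ d ∈ A, 0 ≤ lam d) ∧ (∑ d ∈ A, lam d) = 1 ∧
    (∑ d ∈ A, lam d • intCoe d) = x ∧ t = ∑ d ∈ A, lam d * f d}

theorem concaveMajorant_eq {n : ℕ} (A : Finset (Fin n → ℤ)) (f : (Fin n → ℤ) → ℝ)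
    (x : Fin n → ℝ) : concaveMajorant A f x = sSup (combinationValues A f x) := rfl

theorem combinationValues_nonempty {n : ℕ} {A : Finset (Fin n → ℤ)} (f : (Fin n → ℤ) → ℝ)
    {x : Fin n → ℝ} (hx : x ∈ convexHull ℝ (intCoe '' (A : Set (Fin n → ℤ)))) :
    (combinationValues A f x).Nonempty := by
  classical
  rw [← Finset.coe_image, Finset.mem_convexHull'] at hx
  obtain ⟨w, hw, hw1, hwx⟩ := hx
  rw [Finset.sum_image intCoe_injective.injOn] at hw1 hwx
  exact ⟨_, fun d => w (intCoe d), fun d hd => hw _ (Finset.mem_image_of_mem _ hd), hw1, hwx, rfl⟩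

theorem combinationValues_bddAbove {n : ℕ} (A : Finset (Fin n → ℤ)) (f : (Fin n → ℤ) → ℝ)
    (x : Fin n → ℝ) : BddAbove (combinationValues A f x) := by
  refine ⟨∑ d ∈ A, |f d|, ?_⟩
  rintro _ ⟨lam, h0, h1, -, rfl⟩
  refine Finset.sum_le_sum fun d hd => ?_
  have hle : lam d ≤ 1 := h1 ▸ Finset.single_le_sum h0 hd
  calc lam d * f d ≤ lam d * |f d| := mul_le_mul_of_nonneg_left (le_abs_self _) (h0 d hd)
    _ ≤ |f d| := mul_le_of_le_one_left (abs_nonneg _) hle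

/-- The concave majorant dominates the value of any convex combination of points of `A`,
repetitions allowed. -/
theorem sum_mul_le_concaveMajorant {n : ℕ} {A : Finset (Fin n → ℤ)} (f : (Fin n → ℤ) → ℝ)
    {ι : Type*} (s : Finset ι) {w : ι → ℝ} {z : ι → Fin n → ℤ} (hw : ∀ i ∈ s, 0 ≤ w i)
    (hw1 : ∑ i ∈ s, w i = 1) (hz : ∀ i ∈ s, z i ∈ A) :
    ∑ i ∈ s, w i * f (z i) ≤ concaveMajorant A f (∑ i ∈ s, w i • intCoe (z i)) := by
  classical
  refine le_csSup (combinationValues_bddAbove A f _)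
    ⟨fun d => ∑ i ∈ s with z i = d, w i, fun d _ => ?_, ?_, ?_, ?_⟩
  · exact Finset.sum_nonneg fun i hi => hw i (Finset.mem_filter.1 hi).1
  · rw [Finset.sum_fiberwise_of_maps_to hz, hw1]
  · rw [← Finset.sum_fiberwise_of_maps_to hz]
    refine Finset.sum_congr rfl fun d _ => ?_
    rw [Finset.sum_smul]
    exact Finset.sum_congr rfl fun i hi => by rw [(Finset.mem_filter.1 hi).2]
  · rw [← Finset.sum_fiberwise_of_maps_to hz]
    refine Finset.sum_congr rfl fun d _ => ?_
    rw [Finset.sum_mul]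
    exact Finset.sum_congr rfl fun i hi => by rw [(Finset.mem_filter.1 hi).2]

theorem finite_aggregate_values {n J : ℕ} (A : Fin J → Finset (Fin n → ℤ))
    (u : Fin J → (Fin n → ℤ) → ℝ) (a : Fin n → ℤ) :
    {t | ∃ f : Fin J → (Fin n → ℤ), (∀ j, f j ∈ A j) ∧ ∑ j, f j = a ∧
      t = ∑ j, u j (f j)}.Finite := by
  refine ((Fintype.piFinset A).finite_toSet.image fun f => ∑ j, u j (f j)).subset ?_
  rintro _ ⟨f, hf, -, rfl⟩
  exact ⟨f, by simpa using hf, rfl⟩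

theorem sum_le_aggU {n J : ℕ} {A : Fin J → Finset (Fin n → ℤ)} (u : Fin J → (Fin n → ℤ) → ℝ)
    {f : Fin J → Fin n → ℤ} (hf : ∀ j, f j ∈ A j) :
    ∑ j, u j (f j) ≤ aggU A u (∑ j, f j) :=
  le_csSup (finite_aggregate_values A u _).bddAbove ⟨f, hf, rfl, rfl⟩

theorem exists_sum_eq_aggU {n J : ℕ} {A : Fin J → Finset (Fin n → ℤ)}
    (u : Fin J → (Fin n → ℤ) → ℝ) {a : Fin n → ℤ} (ha : a ∈ aggFinset A) :
    ∃ f : Fin J → Fin n → ℤ, (∀ j, f j ∈ A j) ∧ ∑ j, f j = a ∧ aggU A u a = ∑ j, u j (f j) := by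
  rw [← Finset.mem_coe, coe_aggFinset] at ha
  obtain ⟨f, hf, hfa⟩ := ha
  have hne : {t | ∃ f : Fin J → (Fin n → ℤ), (∀ j, f j ∈ A j) ∧ ∑ j, f j = a ∧
      t = ∑ j, u j (f j)}.Nonempty := ⟨_, f, hf, hfa, rfl⟩
  exact hne.csSup_mem (finite_aggregate_values A u a)

/-- Integrating a function of one coordinate against a product of probability weights. -/
theorem sum_piFinset_prod_mul {ι α : Type*} [Fintype ι] [DecidableEq ι] {A : ι → Finset α}
    {lam : ι → α → ℝ} (h1 : ∀ i, ∑ d ∈ A i, lam i d = 1) (j : ι) (h : α → ℝ) :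
    ∑ f ∈ Fintype.piFinset A, (∏ i, lam i (f i)) * h (f j) = ∑ d ∈ A j, lam j d * h d := by
  calc ∑ f ∈ Fintype.piFinset A, (∏ i, lam i (f i)) * h (f j)
      = ∑ f ∈ Fintype.piFinset A, ∏ i, lam i (f i) * (if i = j then h (f i) else 1) := by
        simp only [Finset.prod_mul_distrib, Finset.prod_ite_eq', Finset.mem_univ, if_true]
    _ = ∏ i, ∑ d ∈ A i, lam i d * (if i = j then h d else 1) :=
        (Finset.prod_univ_sum A fun i d => lam i d * (if i = j then h d else 1)).symm
    _ = ∑ d ∈ A j, lam j d * h d := by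
        rw [Finset.prod_eq_single j (fun i _ hij => by simp [hij, h1]) (by simp)]
        simp

/-- Convex combinations of the individual domains induce, through the product weights, a convex
combination of the aggregate domain of at least the same total value. -/
theorem sum_le_concaveMajorant_aggU {n J : ℕ} {A : Fin J → Finset (Fin n → ℤ)}
    (u : Fin J → (Fin n → ℤ) → ℝ) {g : Fin J → Fin n → ℝ} {t : Fin J → ℝ}
    (ht : ∀ j, t j ∈ combinationValues (A j) (u j) (g j)) :
    ∑ j, t j ≤ concaveMajorant (aggFinset A) (aggU A u) (∑ j, g j) := by
  choose lam h0 h1 hg hv using ht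
  have hw : ∀ f ∈ Fintype.piFinset A, 0 ≤ ∏ i, lam i (f i) := fun f hf =>
    Finset.prod_nonneg fun i _ => h0 i _ (Fintype.mem_piFinset.1 hf i)
  have hw1 : ∑ f ∈ Fintype.piFinset A, ∏ i, lam i (f i) = 1 := by
    rw [← Finset.prod_univ_sum]
    simp [h1]
  have hx : ∑ f ∈ Fintype.piFinset A, (∏ i, lam i (f i)) • intCoe (∑ j, f j) = ∑ j, g j := by
    ext k
    simp only [intCoe_sum, Finset.smul_sum, Finset.sum_apply, Pi.smul_apply, smul_eq_mul]
    rw [Finset.sum_comm]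
    refine Finset.sum_congr rfl fun j _ => ?_
    rw [sum_piFinset_prod_mul h1 j fun d => intCoe d k, ← hg j]
    simp
  calc ∑ j, t j
      = ∑ f ∈ Fintype.piFinset A, (∏ i, lam i (f i)) * ∑ j, u j (f j) := by
        simp only [Finset.mul_sum]
        rw [Finset.sum_comm]
        exact Finset.sum_congr rfl fun j _ => by rw [hv j, sum_piFinset_prod_mul h1 j (u j)]
    _ ≤ ∑ f ∈ Fintype.piFinset A, (∏ i, lam i (f i)) * aggU A u (∑ j, f j) :=
        Finset.sum_le_sum fun f hf => mul_le_mul_of_nonneg_left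
          (sum_le_aggU u (Fintype.mem_piFinset.1 hf)) (hw f hf)
    _ ≤ concaveMajorant (aggFinset A) (aggU A u) (∑ j, g j) := by
        rw [← hx]
        exact sum_mul_le_concaveMajorant (aggU A u) (z := fun f : Fin J → Fin n → ℤ => ∑ j, f j)
          (Fintype.piFinset A) hw hw1 fun f hf => sum_mem_aggFinset (Fintype.mem_piFinset.1 hf)

theorem sum_concaveMajorant_le {n J : ℕ} {A : Fin J → Finset (Fin n → ℤ)}
    (u : Fin J → (Fin n → ℤ) → ℝ) {g : Fin J → Fin n → ℝ}
    (hg : ∀ j, g j ∈ convexHull ℝ (intCoe '' (A j : Set (Fin n → ℤ)))) :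
    ∑ j, concaveMajorant (A j) (u j) (g j) ≤
      concaveMajorant (aggFinset A) (aggU A u) (∑ j, g j) := by
  refine le_of_forall_pos_le_add fun ε hε => ?_
  have hδ : 0 < ε / (J + 1) := by positivity
  choose t ht hlt using fun j => exists_lt_of_lt_csSup
    (combinationValues_nonempty (u j) (hg j)) (sub_lt_self _ hδ)
  calc ∑ j, concaveMajorant (A j) (u j) (g j)
      ≤ ∑ j, (t j + ε / (J + 1)) :=
        Finset.sum_le_sum fun j _ => (sub_lt_iff_lt_add.1 (hlt j)).le
    _ = ∑ j, t j + J * (ε / (J + 1)) := by simp [Finset.sum_add_distrib]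
    _ ≤ _ := by
        refine add_le_add (sum_le_concaveMajorant_aggU u ht) ?_
        rw [mul_div_assoc', div_le_iff₀ (by positivity)]
        nlinarith

/-- A convex combination of the aggregate domain splits into convex combinations of the individual
domains of at least the same total value. -/
theorem exists_le_sum_concaveMajorant {n J : ℕ} {A : Fin J → Finset (Fin n → ℤ)}
    (u : Fin J → (Fin n → ℤ) → ℝ) {x : Fin n → ℝ} {t : ℝ}
    (ht : t ∈ combinationValues (aggFinset A) (aggU A u) x) :
    ∃ g : Fin J → Fin n → ℝ,
      (∀ j, g j ∈ convexHull ℝ (intCoe '' (A j : Set (Fin n → ℤ)))) ∧ ∑ j, g j = x ∧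
        t ≤ ∑ j, concaveMajorant (A j) (u j) (g j) := by
  obtain ⟨lam, h0, h1, rfl, rfl⟩ := ht
  choose! F hF hFa hFu using fun a (ha : a ∈ aggFinset A) => exists_sum_eq_aggU u ha
  refine ⟨fun j => ∑ a ∈ aggFinset A, lam a • intCoe (F a j), fun j => ?_, ?_, ?_⟩
  · exact (convex_convexHull ℝ _).sum_mem h0 h1 fun a ha =>
      subset_convexHull ℝ _ ⟨_, hF a ha j, rfl⟩
  · rw [Finset.sum_comm]
    refine Finset.sum_congr rfl fun a ha => ?_
    rw [← Finset.smul_sum, ← intCoe_sum, hFa a ha]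
  · calc ∑ a ∈ aggFinset A, lam a * aggU A u a
        = ∑ j, ∑ a ∈ aggFinset A, lam a * u j (F a j) := by
          rw [Finset.sum_comm]
          exact Finset.sum_congr rfl fun a ha => by rw [hFu a ha, Finset.mul_sum]
      _ ≤ _ := Finset.sum_le_sum fun j _ =>
          sum_mul_le_concaveMajorant (u j) _ h0 h1 fun a ha => hF a ha j

/-- the concave majorant of the aggregate utility is the maximal total value of the
individual concave majorants over all fractional decompositions. -/
theorem stmt12 {n J : ℕ} (A : Fin J → Finset (Fin n → ℤ)) (u : Fin J → (Fin n → ℤ) → ℝ)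
    (hA : ∀ j, (A j).Nonempty) (hconc : ∀ j, IsConcaveUtility (A j) (u j))
    (x : Fin n → ℝ) (hx : x ∈ convexHull ℝ (intCoe '' aggDomain A)) :
    concaveMajorant (aggFinset A) (aggU A u) x =
      sSup {t : ℝ | ∃ g : Fin J → (Fin n → ℝ),
        (∀ j, g j ∈ convexHull ℝ (intCoe '' ((A j : Set (Fin n → ℤ))))) ∧
        (∑ j, g j) = x ∧ t = ∑ j, concaveMajorant (A j) (u j) (g j)} := by
  rw [← coe_aggFinset] at hx
  have hne := combinationValues_nonempty (aggU A u) hx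
  have hub : ∀ t ∈ {t : ℝ | ∃ g : Fin J → (Fin n → ℝ),
      (∀ j, g j ∈ convexHull ℝ (intCoe '' ((A j : Set (Fin n → ℤ))))) ∧
      (∑ j, g j) = x ∧ t = ∑ j, concaveMajorant (A j) (u j) (g j)},
      t ≤ concaveMajorant (aggFinset A) (aggU A u) x := by
    rintro _ ⟨g, hg, rfl, rfl⟩
    exact sum_concaveMajorant_le u hg
  apply le_antisymm
  · rw [concaveMajorant_eq]
    refine csSup_le hne fun t ht => ?_
    obtain ⟨g, hg, hgx, hle⟩ := exists_le_sum_concaveMajorant u ht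
    exact le_csSup_of_le ⟨_, hub⟩ ⟨g, hg, hgx, rfl⟩ hle
  · obtain ⟨t, ht⟩ := hne
    obtain ⟨g, hg, hgx, -⟩ := exists_le_sum_concaveMajorant u ht
    exact csSup_le ⟨_, g, hg, hgx, rfl⟩ hub
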